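/- For all n ≥ 2, the number of reduced words for the longest element w₀ ∈ S_n equals f^{δ_n}, the number of standard Young tableaux of the staircase shape δ_n = (n−1, n−2, …, 2, 1). -/

import Mathlib

open scoped Classical


/-- The adjacent transposition `sᵢ ∈ S_n` swapping `i` and `i+1` (one-based),
for `i ∈ {1, …, n-1}`; junk value `1` otherwise. -/
def simpleRefl (n i : ℕ) : Equiv.Perm (Fin n) :=
  if h : 1 ≤ i ∧ i < n then Equiv.swap ⟨i - 1, by omega⟩ ⟨i, h.2⟩ else 1

/-- The product `s_{i₁} ⋯ s_{i_m}` of the word `i₁ ⋯ i_m`. -/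
def wordProd (n : ℕ) (l : List ℕ) : Equiv.Perm (Fin n) :=
  (l.map (simpleRefl n)).prod

/-- `l` is a word for `w`: letters in `{1, …, n-1}` and product `w`. -/
def IsWordFor (n : ℕ) (w : Equiv.Perm (Fin n)) (l : List ℕ) : Prop :=
  (∀ i ∈ l, 1 ≤ i ∧ i ≤ n - 1) ∧ wordProd n l = w

/-- `l` is a reduced word for `w`: a word for `w` of minimal length. -/
def IsReducedWordFor (n : ℕ) (w : Equiv.Perm (Fin n)) (l : List ℕ) : Prop :=
  IsWordFor n w l ∧ ∀ l', IsWordFor n w l' → l.length ≤ l'.length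

/-- The longest element `w₀ ∈ S_n`, `w₀(i) = n + 1 - i` in one-line notation. -/
def w₀ (n : ℕ) : Equiv.Perm (Fin n) := Fin.revPerm

/-- The number of positions of the word `l` supporting a commutation,
i.e. positions `k` with `|i_k - i_{k+1}| > 1`. -/
def commCount (l : List ℕ) : ℕ :=
  ((Finset.range (l.length - 1)).filter
    (fun k => 1 < |(l.getD k 0 : ℤ) - (l.getD (k+1) 0 : ℤ)|)).card

/-- The number of consecutive noncommuting pairs in the word `l`,
i.e. positions `k` with `|i_k - i_{k+1}| = 1`. -/
def noncommCount (l : List ℕ) : ℕ :=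
  ((Finset.range (l.length - 1)).filter
    (fun k => |(l.getD k 0 : ℤ) - (l.getD (k+1) 0 : ℤ)| = 1)).card

/-- The number of positions of `l` supporting a long braid move, i.e. positions `k`
with `(i_k, i_{k+1}, i_{k+2})` of the form `(i, i+1, i)` or `(i+1, i, i+1)`. -/
noncomputable def braidCount (l : List ℕ) : ℕ :=
  ((Finset.range (l.length - 2)).filter
    (fun k => ∃ i : ℕ,
      (l.getD k 0, l.getD (k+1) 0, l.getD (k+2) 0) = (i, i+1, i) ∨
      (l.getD k 0, l.getD (k+1) 0, l.getD (k+2) 0) = (i+1, i, i+1))).card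


/-- The cells of the Young diagram of the partition whose parts form the multiset `M`
(rows and columns zero-indexed; cell `(i, j)` is present iff column `j` has height `> i`,
i.e. iff row `i` of the weakly decreasing rearrangement of `M` has length `> j`). -/
def cellsOf (M : Multiset ℕ) : Set (ℕ × ℕ) :=
  {p | p.1 < (M.filter (fun m => p.2 < m)).card}

/-- `T` is a standard Young tableau of the shape with parts `M`: it vanishes off the
diagram, takes each value `1, …, |M|` exactly once on the diagram, and increases
along rows and down columns. -/
def IsSYT (M : Multiset ℕ) (T : ℕ × ℕ → ℕ) : Prop :=
  (∀ p, p ∉ cellsOf M → T p = 0) ∧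
  (∀ m, 1 ≤ m → m ≤ M.sum → ∃! p, p ∈ cellsOf M ∧ T p = m) ∧
  (∀ i j, (i, j + 1) ∈ cellsOf M → T (i, j) < T (i, j + 1)) ∧
  (∀ i j, (i + 1, j) ∈ cellsOf M → T (i, j) < T (i + 1, j))

/-- `f^λ`, the number of standard Young tableaux of the shape with parts `M`. -/
noncomputable def sytCount (M : Multiset ℕ) : ℕ := Nat.card {T // IsSYT M T}

/-- The partition `λ(w)`: the (weakly decreasing rearrangement of the) multiset of the
numbers `rᵢ = #{j < i : w(j) > w(i)}`, zero parts discarded. -/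
def shapeOf (n : ℕ) (w : Equiv.Perm (Fin n)) : Multiset ℕ :=
  (Multiset.ofList (List.ofFn (fun i : Fin n =>
    (Finset.univ.filter (fun j : Fin n => j < i ∧ w i < w j)).card))).filter
    (fun r => 0 < r)

/-- The staircase partition `δ_n = (n-1, n-2, …, 2, 1)`. -/
def staircase (n : ℕ) : Multiset ℕ :=
  Multiset.ofList ((List.range (n - 1)).map (fun i => i + 1))

/-- `w` is vexillary: it avoids the pattern 2143. -/
def Vexillary (n : ℕ) (w : Equiv.Perm (Fin n)) : Prop :=
  ¬ ∃ i₁ i₂ i₃ i₄ : Fin n, i₁ < i₂ ∧ i₂ < i₃ ∧ i₃ < i₄ ∧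
    w i₂ < w i₁ ∧ w i₁ < w i₄ ∧ w i₄ < w i₃

/-- `k` is a left descent of `w`: the value `k + 1` occurs to the left of the value `k`. -/
def LeftDescent (w : Equiv.Perm ℤ) (k : ℤ) : Prop := w.symm (k + 1) < w.symm k

/-- The number of descending chains of length `ℓ` from `w` to `1` in the left weak order that use
only the transpositions `(k, k + 1)` with `-N ≤ k < N`. -/
noncomputable def chainCount (N : ℤ) : ℕ → Equiv.Perm ℤ → ℤ
  | 0, w => if w = 1 then 1 else 0
  | ℓ + 1, w => ∑ k ∈ Finset.Ico (-N) N,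
      if LeftDescent w k then chainCount N ℓ (Equiv.swap k (k + 1) * w) else 0

/-- `w * swap a b` covers `w` in the Bruhat order, for positions `a < b`. -/
def BruhatCover (w : Equiv.Perm ℤ) (a b : ℤ) : Prop :=
  a < b ∧ w a < w b ∧ ∀ x, a < x → x < b → ¬ (w a < w x ∧ w x < w b)

/-- The coefficient of the transposition `swap x r` in the transition formula at `r`. -/
noncomputable def transitionSign (w : Equiv.Perm ℤ) (r x : ℤ) : ℤ :=
  if BruhatCover w x r then 1 else if BruhatCover w r x then -1 else 0

lemma bruhatCover_swap_mul_iff (v : Equiv.Perm ℤ) {a b k : ℤ} (hab : a < b)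
    (h₁ : ¬ (v a = k ∧ v b = k + 1)) (h₂ : ¬ (v a = k + 1 ∧ v b = k)) :
    BruhatCover v a b ∧ LeftDescent (v * Equiv.swap a b) k ↔
      LeftDescent v k ∧ BruhatCover (Equiv.swap k (k + 1) * v) a b := by
  obtain ⟨P, rfl⟩ : ∃ P, k = v P := ⟨v.symm k, by simp⟩
  obtain ⟨Q, hQ⟩ : ∃ Q, v P + 1 = v Q := ⟨v.symm (v P + 1), by simp⟩
  have hab' := v.injective.ne hab.ne
  have hPQ : P ≠ Q := by rintro rfl; omega
  have hsymm : ∀ x, (v * Equiv.swap a b).symm (v x) = Equiv.swap a b x := fun x =>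
    congrArg (Equiv.swap a b) (v.symm_apply_apply x)
  have succ₁ : ∀ x, x ≠ Q → (v P < v x ↔ v Q < v x) := fun x hx => by
    have := v.injective.ne hx; omega
  have succ₂ : ∀ x, x ≠ P → (v x < v Q ↔ v x < v P) := fun x hx => by
    have := v.injective.ne hx; omega
  have hlt : v P < v Q := by omega
  simp only [LeftDescent, BruhatCover, hQ, hsymm, Equiv.symm_apply_apply, Equiv.Perm.mul_apply,
    Equiv.swap_apply_def, v.injective.eq_iff] at h₁ h₂ ⊢
  clear hQ hsymm
  constructor
  · rintro ⟨⟨-, h3, h4⟩, h5⟩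
    have hP := h4 P
    have hQ' := h4 Q
    refine ⟨?_, hab, ?_, ?_⟩
    · grind
    · grind
    · intro x
      have := h4 x
      grind
  · rintro ⟨h5, ⟨-, h3, h4⟩⟩
    have hP := h4 P
    have hQ' := h4 Q
    refine ⟨⟨hab, ?_, ?_⟩, ?_⟩
    · grind
    · intro x
      have := h4 x
      grind
    · grind

lemma transitionSign_mul_ite (v : Equiv.Perm ℤ) {r x k : ℤ} (c : ℤ) (hx : x ≠ r) :
    (transitionSign v r x * if LeftDescent (v * Equiv.swap x r) k then c else 0) -
      (if LeftDescent v k then transitionSign (Equiv.swap k (k + 1) * v) r x * c else 0) =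
    (if v x = k ∧ v r = k + 1 then c else 0) - (if v x = k + 1 ∧ v r = k then c else 0) := by
  have aux : ∀ a b, a < b → v a = k → v b = k + 1 →
      BruhatCover v a b ∧ LeftDescent (v * Equiv.swap a b) k ∧ ¬ LeftDescent v k := by
    rintro a b hab rfl hb
    have hb' : v.symm (v a + 1) = b := by rw [← hb]; simp
    refine ⟨⟨hab, by omega, fun x _ _ => by omega⟩, ?_, ?_⟩
    · have e : ∀ y, (v * Equiv.swap a b).symm y = Equiv.swap a b (v.symm y) := fun _ => rfl
      simp [LeftDescent, e, hb', hab]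
    · simp only [LeftDescent, hb', Equiv.symm_apply_apply]; omega
  have aux' : ∀ a b, a < b → v a = k + 1 → v b = k →
      LeftDescent v k ∧ BruhatCover (Equiv.swap k (k + 1) * v) a b ∧ ¬ BruhatCover v a b := by
    rintro a b hab ha rfl
    have ha' : v.symm (v b + 1) = a := by rw [← ha]; simp
    refine ⟨?_, ⟨hab, ?_, fun x _ _ => ?_⟩, ?_⟩
    · simp [LeftDescent, ha', hab]
    · simp [ha]
    · simp only [Equiv.Perm.mul_apply, ha, Equiv.swap_apply_right, Equiv.swap_apply_left]; omega
    · rintro ⟨_, h, _⟩; omega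
  have lt₁ : ∀ w, BruhatCover w x r → x < r := fun w h => h.1
  have lt₂ : ∀ w, BruhatCover w r x → r < x := fun w h => h.1
  have hxr := v.injective.ne hx
  have gen₁ := fun h => bruhatCover_swap_mul_iff v (a := x) (b := r) (k := k) h
  have gen₂ := fun h => bruhatCover_swap_mul_iff v (a := r) (b := x) (k := k) h
  rw [Equiv.swap_comm r x] at gen₂
  have a1 := aux x r
  have a2 := aux r x
  have a3 := aux' x r
  have a4 := aux' r x
  rw [Equiv.swap_comm r x] at a2
  unfold transitionSign
  rcases lt_or_gt_of_ne hx with h | h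
  · have n1 : ∀ w, ¬ BruhatCover w r x := fun w h' => absurd h (lt₂ w h').not_gt
    simp only [n1, if_false]
    grind
  · have n1 : ∀ w, ¬ BruhatCover w x r := fun w h' => absurd h (lt₁ w h').not_gt
    simp only [n1, if_false]
    grind

lemma swap_mul_mul_swap (v : Equiv.Perm ℤ) {x r k : ℤ}
    (h : (v x = k ∧ v r = k + 1) ∨ (v x = k + 1 ∧ v r = k)) :
    Equiv.swap k (k + 1) * (v * Equiv.swap x r) = v := by
  have : Equiv.swap k (k + 1) = v * Equiv.swap x r * v⁻¹ := by
    rw [Equiv.mul_swap_eq_swap_mul, mul_assoc, mul_inv_cancel, mul_one]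
    rcases h with ⟨rfl, h⟩ | ⟨h, rfl⟩
    · rw [h]
    · rw [h, Equiv.swap_comm]
  rw [this]
  group
  simp

/-- The transition formula: the chain counts of the Bruhat covers `v * swap x r` with `x < r` and
of those with `r < x` have the same total. -/
theorem sum_transitionSign_mul_chainCount (N : ℤ) (ℓ : ℕ) (v : Equiv.Perm ℤ) {r : ℤ}
    (hv : ∀ x, x ≤ -N ∨ N - 1 ≤ x → v x = x) (hr₁ : -N < r) (hr₂ : r < N - 1) :
    ∑ x ∈ Finset.Ico (-N) N, transitionSign v r x * chainCount N ℓ (v * Equiv.swap x r) = 0 := by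
  induction ℓ generalizing v with
  | zero =>
    refine Finset.sum_eq_zero fun x _ => ?_
    simp only [chainCount]
    split_ifs with h
    · have hv' : v = Equiv.swap x r := by
        rw [mul_eq_one_iff_eq_inv] at h; simpa using h
      have n1 : ¬ BruhatCover v x r := by
        rintro ⟨h1, h2, -⟩; simp [hv'] at h2; omega
      have n2 : ¬ BruhatCover v r x := by
        rintro ⟨h1, h2, -⟩; simp [hv'] at h2; omega
      simp [transitionSign, n1, n2]
    · simp
  | succ ℓ ih =>
    have hvr : ∀ x, v x = v r ↔ x = r := fun x => v.injective.eq_iff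
    have rng : -N < v r ∧ v r < N - 1 := by
      by_contra hcon
      have := hv (v r) (by omega)
      rw [v.injective.eq_iff] at this
      omega
    have rng' : ∀ m, -N ≤ m → m < N → -N ≤ v.symm m ∧ v.symm m < N := by
      intro m h1 h2
      by_contra hcon
      have := hv (v.symm m) (by omega)
      simp at this
      omega
    have hrec : ∑ k ∈ Finset.Ico (-N) N, (if LeftDescent v k then
        ∑ x ∈ Finset.Ico (-N) N, transitionSign (Equiv.swap k (k + 1) * v) r x *
          chainCount N ℓ (Equiv.swap k (k + 1) * v * Equiv.swap x r) else 0) = 0 := by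
      refine Finset.sum_eq_zero fun k hk => ?_
      split_ifs with hd
      · apply ih
        intro x hx
        have e1 : ∀ y, y ≤ -N ∨ N - 1 ≤ y → v.symm y = y := fun y hy => by
          rw [Equiv.symm_apply_eq, hv y hy]
        have hvx := hv x hx
        have hk1 : k ≠ x := by
          rintro rfl
          unfold LeftDescent at hd
          rw [e1 k hx] at hd
          rcases hx with hx | hx
          · have := rng' (k + 1) (by simp at hk; omega) (by simp at hk; omega)
            simp at hk; omega
          · rw [e1 (k + 1) (by omega)] at hd; omega
        have hk2 : k + 1 ≠ x := by
          rintro rfl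
          unfold LeftDescent at hd
          rw [e1 (k + 1) hx] at hd
          rcases hx with hx | hx
          · simp at hk; omega
          · by_cases h : N - 1 ≤ k
            · rw [e1 k (by omega)] at hd; omega
            · have := hv (v.symm k)
              simp at this; omega
        rw [Equiv.Perm.mul_apply, hvx, Equiv.swap_apply_of_ne_of_ne hk1.symm hk2.symm]
      · rfl
    rw [← hrec]
    simp only [chainCount, Finset.mul_sum]
    rw [Finset.sum_comm, ← sub_eq_zero, ← Finset.sum_sub_distrib]
    have hterm : ∀ k ∈ Finset.Ico (-N) N,
        (∑ x ∈ Finset.Ico (-N) N, (transitionSign v r x *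
          if LeftDescent (v * Equiv.swap x r) k then
            chainCount N ℓ (Equiv.swap k (k + 1) * (v * Equiv.swap x r)) else 0)) -
        (if LeftDescent v k then ∑ x ∈ Finset.Ico (-N) N,
          transitionSign (Equiv.swap k (k + 1) * v) r x *
            chainCount N ℓ (Equiv.swap k (k + 1) * v * Equiv.swap x r) else 0) =
        (if k = v r - 1 then chainCount N ℓ v else 0) - (if k = v r then chainCount N ℓ v else 0) := by
      intro k hk
      have e : (if LeftDescent v k then ∑ x ∈ Finset.Ico (-N) N,
          transitionSign (Equiv.swap k (k + 1) * v) r x *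
            chainCount N ℓ (Equiv.swap k (k + 1) * v * Equiv.swap x r) else 0) =
          ∑ x ∈ Finset.Ico (-N) N, if LeftDescent v k then
            transitionSign (Equiv.swap k (k + 1) * v) r x *
            chainCount N ℓ (Equiv.swap k (k + 1) * v * Equiv.swap x r) else 0 := by
        split_ifs <;> simp
      rw [e, ← Finset.sum_sub_distrib]
      have e2 : ∀ x ∈ Finset.Ico (-N) N, ((transitionSign v r x *
          if LeftDescent (v * Equiv.swap x r) k then
            chainCount N ℓ (Equiv.swap k (k + 1) * (v * Equiv.swap x r)) else 0) -
          (if LeftDescent v k then transitionSign (Equiv.swap k (k + 1) * v) r x *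
            chainCount N ℓ (Equiv.swap k (k + 1) * v * Equiv.swap x r) else 0)) =
          (if x = v.symm (v r - 1) then (if k = v r - 1 then chainCount N ℓ v else 0) else 0) -
          (if x = v.symm (v r + 1) then (if k = v r then chainCount N ℓ v else 0) else 0) := by
        intro x _
        have hx1 : x = v.symm (v r - 1) ↔ v x = v r - 1 := by
          rw [Equiv.eq_symm_apply]
        have hx2 : x = v.symm (v r + 1) ↔ v x = v r + 1 := by
          rw [Equiv.eq_symm_apply]
        by_cases hx : x = r
        · subst hx
          have n1 : ∀ w, ¬ BruhatCover w x x := fun w h => lt_irrefl _ h.1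
          rw [if_neg (c := x = v.symm (v x - 1)) (by rw [hx1]; omega),
            if_neg (c := x = v.symm (v x + 1)) (by rw [hx2]; omega)]
          simp [transitionSign, n1]
        · rw [mul_assoc, transitionSign_mul_ite v _ hx]
          have := @swap_mul_mul_swap v x r k
          simp only [hx1, hx2]
          by_cases c1 : v x = k ∧ v r = k + 1
          · rw [this (Or.inl c1)]
            grind
          · by_cases c2 : v x = k + 1 ∧ v r = k
            · rw [this (Or.inr c2)]
              grind
            · grind
      rw [Finset.sum_congr rfl e2, Finset.sum_sub_distrib, Finset.sum_ite_eq', Finset.sum_ite_eq',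
        if_pos (Finset.mem_Ico.2 (rng' _ (by omega) (by omega))),
        if_pos (Finset.mem_Ico.2 (rng' _ (by omega) (by omega)))]
    rw [Finset.sum_congr rfl hterm, Finset.sum_sub_distrib, Finset.sum_ite_eq', Finset.sum_ite_eq',
      if_pos (by simp; omega), if_pos (by simp; omega), sub_self]

/-- If there is a unique Bruhat cover on each side of `r`, their chain counts agree. -/
theorem chainCount_mul_swap_eq {N : ℤ} (ℓ : ℕ) (v : Equiv.Perm ℤ) {i r s : ℤ}
    (hv : ∀ x, x ≤ -N ∨ N - 1 ≤ x → v x = x) (hi : -N ≤ i) (hir : i < r) (hrs : r < s)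
    (hs : s < N) (hvi : v i < v r) (hvs : v r < v s)
    (hleft : ∀ x < r, v x < v r → x ≤ i ∧ v x ≤ v i)
    (hright : ∀ x > r, v r < v x → s ≤ x ∧ v s ≤ v x) :
    chainCount N ℓ (v * Equiv.swap i r) = chainCount N ℓ (v * Equiv.swap s r) := by
  have h := sum_transitionSign_mul_chainCount N ℓ v hv (r := r) (by omega) (by omega)
  have ci : transitionSign v r i = 1 := by
    rw [transitionSign, if_pos]
    exact ⟨hir, hvi, fun x h₁ h₂ h₃ => by have := hleft x h₂ h₃.2; omega⟩
  have cs : transitionSign v r s = -1 := by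
    rw [transitionSign, if_neg (fun h => by have := h.1; omega), if_pos]
    exact ⟨hrs, hvs, fun x h₁ h₂ h₃ => by have := hright x h₁ h₃.1; omega⟩
  have c0 : ∀ x, x ≠ i → x ≠ s → transitionSign v r x = 0 := by
    intro x hxi hxs
    rw [transitionSign, if_neg, if_neg]
    · rintro ⟨h₁, h₂, h₃⟩
      have h₄ := hright x h₁ h₂
      have h₅ := v.injective.ne hxs
      exact h₃ s hrs (by omega) ⟨hvs, by omega⟩
    · rintro ⟨h₁, h₂, h₃⟩
      have h₄ := hleft x h₁ h₂
      have h₅ := v.injective.ne hxi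
      exact h₃ i (by omega) hir ⟨by omega, hvi⟩
  rw [Finset.sum_eq_add i s (by omega) (fun x _ hx => by rw [c0 x hx.1 hx.2, zero_mul])
    (fun h => absurd (Finset.mem_Ico.2 ⟨hi, by omega⟩) h)
    (fun h => absurd (Finset.mem_Ico.2 ⟨by omega, hs⟩) h), ci, cs] at h
  omega

/-- The permutations interpolating between the longest element of the symmetric group on
`{1, …, n}` and a Grassmannian permutation of staircase shape. -/
def interpolation (n m j p : ℤ) : ℤ :=
  if -j < p ∧ p ≤ 0 then 2 * p + m + 1
  else if -m ≤ p ∧ p ≤ -j then 2 * p + m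
  else if 1 ≤ p ∧ p < n - 1 - m then n + 1 - p
  else if p = n - 1 - m then m + 2 - 2 * j
  else if n - m ≤ p ∧ p ≤ n - j then 2 * p - 2 * n + m + 1
  else if n - j < p ∧ p ≤ n then 2 * p - 2 * n + m + 2
  else p

lemma exists_interpolation_succ {n m j : ℤ} (hj : 0 ≤ j) (hjm : j ≤ m) (hmn : m + 2 ≤ n)
    (u : Equiv.Perm ℤ) (hu : ∀ p, u p = interpolation n m j p) :
    ∃ u' : Equiv.Perm ℤ, (∀ p, u' p = interpolation n m (j + 1) p) ∧
      ∀ ℓ, chainCount (n + 3) ℓ u' = chainCount (n + 3) ℓ u := by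
  let v := u * Equiv.swap (n - j) (n - 1 - m)
  have hv : u = v * Equiv.swap (n - j) (n - 1 - m) := by simp [v, mul_assoc]
  have hr : v (n - 1 - m) = m + 1 - 2 * j := by
    simp only [v, Equiv.Perm.mul_apply, Equiv.swap_apply_right, hu]
    unfold interpolation; split_ifs <;> omega
  have hs : v (n - j) = m + 2 - 2 * j := by
    simp only [v, Equiv.Perm.mul_apply, Equiv.swap_apply_left, hu]
    unfold interpolation; split_ifs <;> omega
  have hne : ∀ p, p ≠ n - j → p ≠ n - 1 - m → v p = interpolation n m j p := fun p h₁ h₂ => by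
    rw [← hu, Equiv.Perm.mul_apply, Equiv.swap_apply_of_ne_of_ne h₁ h₂]
  have hi : v (-j) = m - 2 * j := by
    rw [hne _ (by omega) (by omega)]; unfold interpolation; split_ifs <;> omega
  have hvp : ∀ p, (p = n - j ∧ v p = m + 2 - 2 * j) ∨ (p = n - 1 - m ∧ v p = m + 1 - 2 * j) ∨
      (p ≠ n - j ∧ p ≠ n - 1 - m ∧ v p = interpolation n m j p) := by
    intro p
    by_cases h₁ : p = n - j
    · subst h₁; omega
    · by_cases h₂ : p = n - 1 - m
      · subst h₂; omega
      · exact Or.inr (Or.inr ⟨h₁, h₂, hne p h₁ h₂⟩)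
  clear_value v
  refine ⟨v * Equiv.swap (-j) (n - 1 - m), fun p => ?_, fun ℓ => ?_⟩
  · rw [Equiv.Perm.mul_apply]
    by_cases h₁ : p = -j
    · rw [h₁, Equiv.swap_apply_left, hr]
      unfold interpolation; split_ifs <;> omega
    by_cases h₂ : p = n - 1 - m
    · rw [h₂, Equiv.swap_apply_right, hi]
      unfold interpolation; split_ifs <;> omega
    rw [Equiv.swap_apply_of_ne_of_ne h₁ h₂]
    have := hvp p
    unfold interpolation at this ⊢
    split_ifs at this ⊢ <;> omega
  · rw [hv]
    apply chainCount_mul_swap_eq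
    · intro x hx
      have := hvp x
      unfold interpolation at this; split_ifs at this <;> omega
    · omega
    · omega
    · omega
    · omega
    · omega
    · omega
    · intro x hx
      rw [hr, hi]
      have := hvp x
      unfold interpolation at this; split_ifs at this <;> omega
    · intro x hx
      rw [hr, hs]
      have := hvp x
      unfold interpolation at this; split_ifs at this <;> omega

lemma exists_interpolation {n : ℤ} (w : Equiv.Perm ℤ) (hw : ∀ p, w p = interpolation n 0 0 p)
    (m : ℕ) (hm : m + 2 ≤ n) (j : ℕ) (hj : j ≤ m + 1) :
    ∃ u : Equiv.Perm ℤ, (∀ p, u p = interpolation n m j p) ∧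
      ∀ ℓ, chainCount (n + 3) ℓ u = chainCount (n + 3) ℓ w := by
  induction m generalizing j with
  | zero =>
    induction j with
    | zero => exact ⟨w, by simpa using hw, fun _ => rfl⟩
    | succ j ih =>
      obtain ⟨u, hu, hc⟩ := ih (by omega)
      obtain ⟨u', hu', hc'⟩ := exists_interpolation_succ (by omega) (by omega) hm u hu
      exact ⟨u', by exact_mod_cast hu', fun ℓ => (hc' ℓ).trans (hc ℓ)⟩
  | succ m ihm =>
    induction j with
    | zero =>
      obtain ⟨u, hu, hc⟩ := ihm (by push_cast at hm; omega) (m + 1) le_rfl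
      refine ⟨u, fun p => ?_, hc⟩
      rw [hu]
      push_cast at hm ⊢
      unfold interpolation
      split_ifs <;> omega
    | succ j ih =>
      obtain ⟨u, hu, hc⟩ := ih (by omega)
      obtain ⟨u', hu', hc'⟩ := exists_interpolation_succ (by omega) (by push_cast; omega) hm u hu
      exact ⟨u', by exact_mod_cast hu', fun ℓ => (hc' ℓ).trans (hc ℓ)⟩

/-- A permutation of `ℤ` that is strictly increasing and fixes a point is the identity. -/
lemma perm_int_eq_one_of_strictMono (w : Equiv.Perm ℤ) (hw : StrictMono w) {a : ℤ}
    (ha : w a = a) : w = 1 := by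
  have succ : ∀ x, w (x + 1) = w x + 1 := by
    intro x
    have h₁ := hw (lt_add_one x)
    by_contra h₂
    obtain ⟨y, hy⟩ : ∃ y, w y = w x + 1 := ⟨w.symm (w x + 1), by simp⟩
    have h₃ : x < y := hw.lt_iff_lt.1 (by omega)
    have h₄ : y < x + 1 := hw.lt_iff_lt.1 (by omega)
    omega
  ext x
  have up : ∀ n : ℕ, w (a + n) = a + n := fun n => by
    induction n with
    | zero => simpa using ha
    | succ n ih => push_cast; rw [← add_assoc, succ, ih]
  have down : ∀ n : ℕ, w (a - n) = a - n := fun n => by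
    induction n with
    | zero => simpa using ha
    | succ n ih =>
      have := succ (a - (n + 1 : ℕ))
      rw [show a - ((n + 1 : ℕ) : ℤ) + 1 = a - n by push_cast; ring, ih] at this
      omega
  rcases le_total a x with h | h
  · have := up (x - a).toNat
    rwa [Int.toNat_of_nonneg (by omega), add_sub_cancel] at this
  · have := down (a - x).toNat
    rwa [Int.toNat_of_nonneg (by omega), sub_sub_cancel] at this

/-- `T` is a standard filling with entries `1, …, ℓ` of the diagram with row lengths `lam`. -/
def IsStdFilling (ℓ : ℕ) (lam : ℕ → ℕ) (T : ℕ × ℕ → ℕ) : Prop :=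
  (∀ i j, lam i ≤ j → T (i, j) = 0) ∧
  (∀ i j, j < lam i → 1 ≤ T (i, j) ∧ T (i, j) ≤ ℓ) ∧
  (∀ m, 1 ≤ m → m ≤ ℓ → ∃! p : ℕ × ℕ, p.2 < lam p.1 ∧ T p = m) ∧
  (∀ i j, j + 1 < lam i → T (i, j) < T (i, j + 1)) ∧
  (∀ i j, j < lam (i + 1) → T (i, j) < T (i + 1, j))

/-- The row lengths after removing the last cell of row `i`. -/
def removeCell (lam : ℕ → ℕ) (i : ℕ) : ℕ → ℕ := Function.update lam i (lam i - 1)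

lemma removeCell_apply (lam : ℕ → ℕ) (i x : ℕ) :
    removeCell lam i x = if x = i then lam i - 1 else lam x := by
  simp [removeCell, Function.update_apply]

lemma IsStdFilling.addCell {ℓ : ℕ} {lam : ℕ → ℕ} {T : ℕ × ℕ → ℕ} (hlam : Antitone lam) {i : ℕ}
    (hi : lam (i + 1) < lam i) (hT : IsStdFilling ℓ (removeCell lam i) T) :
    IsStdFilling (ℓ + 1) lam (Function.update T (i, lam i - 1) (ℓ + 1)) := by
  obtain ⟨h₁, h₂, h₃, h₄, h₅⟩ := hT
  have cell : ∀ a b, b < lam a → (a, b) ≠ (i, lam i - 1) → b < removeCell lam i a := by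
    intro a b hb hne
    rw [removeCell_apply]
    split_ifs with h
    · subst h; simp at hne; omega
    · exact hb
  have sub : ∀ a, removeCell lam i a ≤ lam a := by
    intro a; rw [removeCell_apply]; split_ifs with h
    · subst h; omega
    · rfl
  have nmem : ¬ lam i - 1 < removeCell lam i i := by simp [removeCell_apply]
  refine ⟨fun a b hab => ?_, fun a b hab => ?_, fun m hm₁ hm₂ => ?_, fun a b hab => ?_,
    fun a b hab => ?_⟩
  · rw [Function.update_of_ne]
    · exact h₁ a b ((sub a).trans hab)
    · rintro h; simp only [Prod.mk.injEq] at h; obtain ⟨rfl, rfl⟩ := h; omega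
  · by_cases h : (a, b) = (i, lam i - 1)
    · rw [h, Function.update_self]; omega
    · rw [Function.update_of_ne h]
      have := h₂ a b (cell a b hab h); omega
  · by_cases hm : m = ℓ + 1
    · refine ⟨(i, lam i - 1), ⟨by dsimp only; omega, by rw [Function.update_self, hm]⟩, ?_⟩
      rintro ⟨a, b⟩ ⟨hp₁, hp₂⟩
      by_contra h
      rw [Function.update_of_ne h] at hp₂
      have := h₂ a b (cell a b hp₁ h); omega
    · obtain ⟨⟨a, b⟩, ⟨hp₁, hp₂⟩, hp₃⟩ := h₃ m hm₁ (by omega)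
      have hne : (a, b) ≠ (i, lam i - 1) := by
        rintro h; simp only [Prod.mk.injEq] at h; obtain ⟨rfl, rfl⟩ := h; exact nmem hp₁
      refine ⟨(a, b), ⟨lt_of_lt_of_le hp₁ (sub a), by rw [Function.update_of_ne hne, hp₂]⟩, ?_⟩
      rintro ⟨c, d⟩ ⟨hq₁, hq₂⟩
      by_cases h : (c, d) = (i, lam i - 1)
      · rw [h, Function.update_self] at hq₂; omega
      · rw [Function.update_of_ne h] at hq₂
        exact hp₃ (c, d) ⟨cell c d hq₁ h, hq₂⟩
  · have hne : (a, b) ≠ (i, lam i - 1) := by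
      rintro h; simp only [Prod.mk.injEq] at h; obtain ⟨rfl, rfl⟩ := h; omega
    rw [Function.update_of_ne hne]
    by_cases h : (a, b + 1) = (i, lam i - 1)
    · rw [h, Function.update_self]
      have := h₂ a b (cell a b (by omega) hne); omega
    · rw [Function.update_of_ne h]
      exact h₄ a b (cell a (b + 1) hab h)
  · have hne : (a, b) ≠ (i, lam i - 1) := by
      rintro h; simp only [Prod.mk.injEq] at h; obtain ⟨rfl, rfl⟩ := h; omega
    have hle := hlam (Nat.le_succ a)
    rw [Function.update_of_ne hne]
    by_cases h : (a + 1, b) = (i, lam i - 1)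
    · rw [h, Function.update_self]
      have := h₂ a b (cell a b (by simp only [Nat.succ_eq_add_one] at hle; omega) hne); omega
    · rw [Function.update_of_ne h]
      exact h₅ a b (cell (a + 1) b hab h)

lemma IsStdFilling.exists_removeCell {ℓ : ℕ} {lam : ℕ → ℕ} {T : ℕ × ℕ → ℕ}
    (hT : IsStdFilling (ℓ + 1) lam T) :
    ∃ i, lam (i + 1) < lam i ∧ T (i, lam i - 1) = ℓ + 1 ∧
      IsStdFilling ℓ (removeCell lam i) (Function.update T (i, lam i - 1) 0) := by
  obtain ⟨h₁, h₂, h₃, h₄, h₅⟩ := hT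
  obtain ⟨⟨i, j⟩, ⟨hij, hTij⟩, huniq⟩ := h₃ (ℓ + 1) (by omega) le_rfl
  dsimp only at hij
  have hj : j = lam i - 1 := by
    by_contra h
    have := h₄ i j (by omega)
    have := h₂ i (j + 1) (by omega)
    omega
  subst hj
  have hi : lam (i + 1) < lam i := by
    by_contra h
    have := h₅ i (lam i - 1) (by omega)
    have := h₂ (i + 1) (lam i - 1) (by omega)
    omega
  have cell : ∀ a b, b < removeCell lam i a ↔ b < lam a ∧ (a, b) ≠ (i, lam i - 1) := by
    intro a b
    rw [removeCell_apply]
    split_ifs with h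
    · subst h; simp; omega
    · simp [h]
  refine ⟨i, hi, hTij, fun a b hab => ?_, fun a b hab => ?_, fun m hm₁ hm₂ => ?_,
    fun a b hab => ?_, fun a b hab => ?_⟩
  · by_cases h : (a, b) = (i, lam i - 1)
    · rw [h, Function.update_self]
    · rw [Function.update_of_ne h]
      have := cell a b
      exact h₁ a b (by by_contra h'; exact absurd ((cell a b).2 ⟨by omega, h⟩) (by omega))
  · obtain ⟨hab, h⟩ := (cell a b).1 hab
    rw [Function.update_of_ne h]
    have := h₂ a b hab
    have : T (a, b) ≠ ℓ + 1 := fun h' => h (huniq (a, b) ⟨hab, h'⟩)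
    omega
  · obtain ⟨⟨a, b⟩, ⟨hp₁, hp₂⟩, hp₃⟩ := h₃ m hm₁ (by omega)
    have hne : (a, b) ≠ (i, lam i - 1) := by
      intro h; rw [h] at hp₂; omega
    refine ⟨(a, b), ⟨(cell a b).2 ⟨hp₁, hne⟩, by rw [Function.update_of_ne hne, hp₂]⟩, ?_⟩
    rintro ⟨c, d⟩ ⟨hq₁, hq₂⟩
    obtain ⟨hcd, h⟩ := (cell c d).1 hq₁
    rw [Function.update_of_ne h] at hq₂
    exact hp₃ (c, d) ⟨hcd, hq₂⟩
  · obtain ⟨hab, h⟩ := (cell a (b + 1)).1 hab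
    rw [Function.update_of_ne h, Function.update_of_ne]
    · exact h₄ a b hab
    · rintro h'; simp only [Prod.mk.injEq] at h'; obtain ⟨rfl, rfl⟩ := h'; omega
  · obtain ⟨hab, h⟩ := (cell (a + 1) b).1 hab
    rw [Function.update_of_ne h, Function.update_of_ne]
    · exact h₅ a b hab
    · rintro h'; simp only [Prod.mk.injEq] at h'; obtain ⟨rfl, rfl⟩ := h'; omega

/-- The recursion for standard fillings according to the position of the largest entry. -/
lemma card_isStdFilling_succ (ℓ : ℕ) {lam : ℕ → ℕ} (hlam : Antitone lam) (S : Finset ℕ)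
    (hS : ∀ i, i ∈ S ↔ lam (i + 1) < lam i)
    (hfin : ∀ i ∈ S, Finite {T // IsStdFilling ℓ (removeCell lam i) T}) :
    Finite {T // IsStdFilling (ℓ + 1) lam T} ∧
      Nat.card {T // IsStdFilling (ℓ + 1) lam T} =
        ∑ i ∈ S, Nat.card {T // IsStdFilling ℓ (removeCell lam i) T} := by
  let F : (Σ i : S, {T // IsStdFilling ℓ (removeCell lam i) T}) →
      {T // IsStdFilling (ℓ + 1) lam T} := fun x =>
    ⟨Function.update x.2.1 (x.1.1, lam x.1.1 - 1) (ℓ + 1),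
      x.2.2.addCell hlam ((hS _).1 x.1.2)⟩
  have hF : Function.Bijective F := by
    constructor
    · rintro ⟨⟨i, hi⟩, ⟨T, hT⟩⟩ ⟨⟨i', hi'⟩, ⟨T', hT'⟩⟩ h
      have h' : Function.update T (i, lam i - 1) (ℓ + 1) =
          Function.update T' (i', lam i' - 1) (ℓ + 1) := congrArg Subtype.val h
      have hf := hT.addCell hlam ((hS i).1 hi)
      obtain ⟨p, -, hp⟩ := hf.2.2.1 (ℓ + 1) (by omega) le_rfl
      have ci := (hS i).1 hi
      have ci' := (hS i').1 hi'
      have e₁ := hp (i, lam i - 1) ⟨by dsimp only; omega, by rw [Function.update_self]⟩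
      have e₂ := hp (i', lam i' - 1) ⟨by dsimp only; omega, by rw [h', Function.update_self]⟩
      obtain rfl : i = i' := congrArg Prod.fst (e₁.trans e₂.symm)
      have : T = T' := by
        funext q
        by_cases hq : q = (i, lam i - 1)
        · rw [hq, hT.1 _ _ (by simp [removeCell_apply]), hT'.1 _ _ (by simp [removeCell_apply])]
        · have := congrFun h' q
          rwa [Function.update_of_ne hq, Function.update_of_ne hq] at this
      subst this
      rfl
    · rintro ⟨T, hT⟩
      obtain ⟨i, hi, hTi, hT'⟩ := hT.exists_removeCell
      refine ⟨⟨⟨i, (hS i).2 hi⟩, ⟨_, hT'⟩⟩, Subtype.ext ?_⟩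
      simp only [F, Function.update_idem]
      rw [← hTi, Function.update_eq_self]
  have hfin' : ∀ i : S, Finite {T // IsStdFilling ℓ (removeCell lam i) T} := fun i => hfin i i.2
  refine ⟨Finite.of_surjective F hF.2, ?_⟩
  rw [← Nat.card_congr (Equiv.ofBijective F hF), Nat.card_sigma,
    Finset.sum_coe_sort S (fun i => Nat.card {T // IsStdFilling ℓ (removeCell lam i) T})]

/-- Standard fillings are counted by the descending chains of the Grassmannian permutation. -/
theorem card_isStdFilling (N : ℤ) (B : ℕ) (hB : B < N) (ℓ : ℕ) (lam : ℕ → ℕ) (w : Equiv.Perm ℤ)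
    (hlam : Antitone lam) (hw : ∀ i : ℕ, w (-i) = lam i - i)
    (hmono : ∀ p q, 0 < p → p < q → w p < w q) (hN : lam 0 ≤ N) (hlamB : lam B = 0) :
    Finite {T // IsStdFilling ℓ lam T} ∧
      (Nat.card {T // IsStdFilling ℓ lam T} : ℤ) = chainCount N ℓ w := by
  induction ℓ generalizing lam w with
  | zero =>
    by_cases h0 : lam 0 = 0
    · have hz : ∀ i, lam i = 0 := fun i => Nat.le_zero.1 (h0 ▸ hlam (Nat.zero_le i))
      have hw1 : w = 1 := by
        refine perm_int_eq_one_of_strictMono w ?_ (a := 0) (by simpa [h0] using hw 0)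
        have neg : ∀ p ≤ 0, w p = p := fun p hp => by
          have := hw p.natAbs
          rw [hz] at this
          rw [show p = -(p.natAbs : ℤ) by omega, this]; simp
        have pos : ∀ p, 0 < p → 0 < w p := fun p hp => by
          by_contra h
          have := neg (w p) (by omega)
          rw [w.injective.eq_iff] at this
          omega
        intro p q hpq
        by_cases hp : p ≤ 0
        · by_cases hq : q ≤ 0
          · rwa [neg p hp, neg q hq]
          · rw [neg p hp]; have := pos q (by omega); omega
        · exact hmono p q (by omega) hpq
      have : Unique {T // IsStdFilling 0 lam T} :=
        { default := ⟨fun _ => 0, fun _ _ _ => rfl, fun i j h => by simp [hz] at h,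
            fun m h₁ h₂ => by omega, fun i j h => by simp [hz] at h, fun i j h => by simp [hz] at h⟩
          uniq := fun T => Subtype.ext (funext fun p => T.2.1 p.1 p.2 (by simp [hz])) }
      refine ⟨inferInstance, ?_⟩
      rw [Nat.card_unique]
      simp [chainCount, hw1]
    · have : IsEmpty {T // IsStdFilling 0 lam T} := ⟨fun T => by
        have := T.2.2.1 0 0 (by omega); omega⟩
      refine ⟨inferInstance, ?_⟩
      have hw1 : w ≠ 1 := by
        rintro rfl
        have := hw 0
        simp at this
        omega
      simp [chainCount, hw1]
  | succ ℓ ih =>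
    let S := (Finset.range B).filter fun i => lam (i + 1) < lam i
    have hS : ∀ i, i ∈ S ↔ lam (i + 1) < lam i := by
      intro i
      simp only [S, Finset.mem_filter, Finset.mem_range, and_iff_right_iff_imp]
      intro h
      by_contra h'
      have := hlam (not_lt.1 h')
      omega
    have corner : ∀ i, lam (i + 1) < lam i → 0 < w.symm (lam i - i - 1) := by
      intro i hi
      by_contra h
      have h₁ := hw (w.symm (lam i - i - 1)).natAbs
      rw [show -((w.symm (lam i - i - 1)).natAbs : ℤ) = w.symm (lam i - i - 1) by omega,
        Equiv.apply_symm_apply] at h₁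
      rcases le_or_gt (w.symm (lam i - i - 1)).natAbs i with h₂ | h₂
      · have := hlam h₂; omega
      · have := hlam h₂; simp only [Nat.succ_eq_add_one] at this; omega
    have hsymm : ∀ i : ℕ, w.symm (lam i - i) = -i := fun i => by
      rw [Equiv.symm_apply_eq, hw]
    have step : ∀ i ∈ S, Finite {T // IsStdFilling ℓ (removeCell lam i) T} ∧
        (Nat.card {T // IsStdFilling ℓ (removeCell lam i) T} : ℤ) =
          chainCount N ℓ (Equiv.swap ((lam i : ℤ) - i - 1) (lam i - i) * w) := by
      intro i hi
      have hi' := (hS i).1 hi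
      have hk := corner i hi'
      have hk₁ : ∀ p, w p = lam i - i - 1 → 0 < p := fun p hp => by
        rw [← hp, Equiv.symm_apply_apply] at hk; exact hk
      have hk₂ : ∀ p, w p = lam i - i → p = -i := fun p hp => by
        rw [← hw] at hp; exact w.injective hp
      apply ih
      · intro a b hab
        have := hlam hab
        simp only [removeCell_apply]
        split_ifs with h₁ h₂ h₂
        · rfl
        · subst h₁; omega
        · subst h₂
          have := hlam (show a + 1 ≤ b by omega)
          omega
        · exact this
      · intro a
        rw [Equiv.Perm.mul_apply, removeCell_apply]
        split_ifs with h
        · rw [h, hw, Equiv.swap_apply_right]; omega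
        · rw [Equiv.swap_apply_of_ne_of_ne, hw]
          · intro h'; have := hk₁ _ h'; omega
          · intro h'; have := hk₂ _ h'; omega
      · intro p q hp hpq
        have h₁ := hmono p q hp hpq
        have h₂ := hk₂ p
        have h₃ := hk₂ q
        simp only [Equiv.Perm.mul_apply, Equiv.swap_apply_def]
        split_ifs <;> omega
      · rw [removeCell_apply]; split_ifs with h
        · subst h; omega
        · exact hN
      · rw [removeCell_apply]; split_ifs with h
        · subst h; omega
        · exact hlamB
    obtain ⟨hfin, hcard⟩ := card_isStdFilling_succ ℓ hlam S hS fun i hi => (step i hi).1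
    refine ⟨hfin, ?_⟩
    rw [hcard, Nat.cast_sum, Finset.sum_congr rfl fun i hi => (step i hi).2, chainCount,
      ← Finset.sum_filter]
    refine Finset.sum_nbij (fun i => (lam i : ℤ) - i - 1) ?_ ?_ ?_ ?_
    · intro i hi
      have hi' := (hS i).1 hi
      have hiB : i < B := by simp [S] at hi; exact hi.1
      have := hlam (Nat.zero_le i)
      have := corner i hi'
      rw [Finset.mem_filter, Finset.mem_Ico, LeftDescent, sub_add_cancel, hsymm]
      refine ⟨⟨by omega, by omega⟩, by omega⟩
    · intro i _ j _ hij
      have h : (lam i : ℤ) - i = lam j - j := by simpa using hij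
      rw [← hw, ← hw] at h
      have := w.injective h
      omega
    · intro k hk
      rw [Finset.mem_coe, Finset.mem_filter, LeftDescent] at hk
      obtain ⟨-, hk⟩ := hk
      obtain ⟨Q, hQ⟩ : ∃ Q, w Q = k + 1 := ⟨w.symm (k + 1), by simp⟩
      obtain ⟨P, rfl⟩ : ∃ P, w P = k := ⟨w.symm k, by simp⟩
      rw [← hQ, Equiv.symm_apply_apply, Equiv.symm_apply_apply] at hk
      have hQ0 : Q ≤ 0 := by
        by_contra h
        have := hmono Q P (by omega) hk
        omega
      have eQ := hw Q.natAbs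
      rw [show -(Q.natAbs : ℤ) = Q by omega] at eQ
      have hP0 : 0 < P := by
        by_contra h
        have eP := hw P.natAbs
        rw [show -(P.natAbs : ℤ) = P by omega] at eP
        have := hlam (show P.natAbs ≤ Q.natAbs by omega)
        omega
      refine ⟨Q.natAbs, Finset.mem_coe.2 ((hS _).2 ?_), by dsimp only; omega⟩
      refine lt_of_le_of_ne (hlam (Nat.le_succ _)) fun h => ?_
      have e := hw (Q.natAbs + 1)
      rw [h] at e
      have := w.injective (show w (-((Q.natAbs + 1 : ℕ) : ℤ)) = w P by rw [e]; omega)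
      omega
    · intro i _
      simp

/-- `w` fixes every integer outside `{1, …, n}`. -/
def FixesOutside (n : ℕ) (w : Equiv.Perm ℤ) : Prop := ∀ x : ℤ, x < 1 ∨ (n : ℤ) < x → w x = x

lemma FixesOutside.mem_of_mem {n : ℕ} {w : Equiv.Perm ℤ} (hw : FixesOutside n w) {x : ℤ}
    (h : 1 ≤ w x ∧ w x ≤ n) : 1 ≤ x ∧ x ≤ n := by
  by_contra h'
  have := hw x (by omega)
  omega

lemma FixesOutside.one_le_and_lt {n : ℕ} {w : Equiv.Perm ℤ} (hw : FixesOutside n w) {k : ℤ}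
    (hk : LeftDescent w k) : 1 ≤ k ∧ k < n := by
  obtain ⟨Q, hQ⟩ : ∃ Q, w Q = k + 1 := ⟨w.symm (k + 1), by simp⟩
  obtain ⟨P, rfl⟩ : ∃ P, w P = k := ⟨w.symm k, by simp⟩
  rw [LeftDescent, ← hQ, Equiv.symm_apply_apply, Equiv.symm_apply_apply] at hk
  by_contra h
  have h₁ := hw P
  have h₂ := hw Q
  have h₃ := hw (w P)
  have h₄ := hw (w Q)
  simp only [EmbeddingLike.apply_eq_iff_eq] at h₃ h₄
  omega

lemma FixesOutside.swap_mul {n : ℕ} {w : Equiv.Perm ℤ} (hw : FixesOutside n w) {k : ℤ}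
    (hk : 1 ≤ k ∧ k < n) : FixesOutside n (Equiv.swap k (k + 1) * w) := by
  intro x hx
  rw [Equiv.Perm.mul_apply, hw x hx, Equiv.swap_apply_of_ne_of_ne] <;> omega

lemma leftDescent_swap_mul {w : Equiv.Perm ℤ} {k : ℤ} (h : ¬ LeftDescent w k) :
    LeftDescent (Equiv.swap k (k + 1) * w) k := by
  have hne := w.symm.injective.ne (lt_add_one k).ne
  have e : ∀ x, (Equiv.swap k (k + 1) * w).symm x = w.symm (Equiv.swap k (k + 1) x) := fun _ => rfl
  rw [LeftDescent, e, e, Equiv.swap_apply_left, Equiv.swap_apply_right]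
  rw [LeftDescent] at h
  omega

/-- The inversions of `w` with positions in `{1, …, n}`. -/
noncomputable def inversions (n : ℕ) (w : Equiv.Perm ℤ) : Finset (ℤ × ℤ) :=
  (Finset.Icc 1 (n : ℤ) ×ˢ Finset.Icc 1 (n : ℤ)).filter fun p => p.1 < p.2 ∧ w p.2 < w p.1

lemma mem_inversions {n : ℕ} {w : Equiv.Perm ℤ} {a b : ℤ} :
    (a, b) ∈ inversions n w ↔ 1 ≤ a ∧ b ≤ n ∧ a < b ∧ w b < w a := by
  simp only [inversions, Finset.mem_filter, Finset.mem_product, Finset.mem_Icc]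
  omega

lemma card_inversions_of_leftDescent {n : ℕ} {w : Equiv.Perm ℤ} (hw : FixesOutside n w) {k : ℤ}
    (hk : LeftDescent w k) :
    (inversions n w).card = (inversions n (Equiv.swap k (k + 1) * w)).card + 1 := by
  have hkn := hw.one_le_and_lt hk
  obtain ⟨Q, hQ⟩ : ∃ Q, w Q = k + 1 := ⟨w.symm (k + 1), by simp⟩
  obtain ⟨P, rfl⟩ : ∃ P, w P = k := ⟨w.symm k, by simp⟩
  rw [LeftDescent, ← hQ, Equiv.symm_apply_apply, Equiv.symm_apply_apply] at hk
  have hP := hw.mem_of_mem (x := P) (by omega)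
  have hQ' := hw.mem_of_mem (x := Q) (by omega)
  have key : inversions n w =
      insert (Q, P) (inversions n (Equiv.swap (w P) (w P + 1) * w)) := by
    ext ⟨a, b⟩
    rw [Finset.mem_insert, mem_inversions, mem_inversions, Prod.mk.injEq, ← hQ]
    simp only [Equiv.Perm.mul_apply, Equiv.swap_apply_def, w.injective.eq_iff]
    have ha := w.injective.eq_iff (a := a) (b := P)
    have ha' := w.injective.eq_iff (a := a) (b := Q)
    have hb := w.injective.eq_iff (a := b) (b := P)
    have hb' := w.injective.eq_iff (a := b) (b := Q)
    split_ifs <;> subst_vars <;> omega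
  rw [key, Finset.card_insert_of_notMem]
  rw [mem_inversions, Equiv.Perm.mul_apply, Equiv.Perm.mul_apply, Equiv.swap_apply_left, hQ,
    Equiv.swap_apply_right]
  omega

lemma card_inversions_swap_mul_le {n : ℕ} {w : Equiv.Perm ℤ} (hw : FixesOutside n w) {k : ℤ}
    (hk : 1 ≤ k ∧ k < n) :
    (inversions n (Equiv.swap k (k + 1) * w)).card ≤ (inversions n w).card + 1 := by
  by_cases h : LeftDescent w k
  · have := card_inversions_of_leftDescent hw h; omega
  · have := card_inversions_of_leftDescent (hw.swap_mul hk) (leftDescent_swap_mul h)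
    rw [Equiv.swap_mul_self_mul] at this
    omega

/-- The word `l` describes a descending chain from `w` to `1` in the left weak order. -/
def IsDescending : List ℕ → Equiv.Perm ℤ → Prop
  | [], w => w = 1
  | k :: l, w => LeftDescent w k ∧ IsDescending l (Equiv.swap (k : ℤ) (k + 1) * w)

/-- The product of a word as a permutation of the integers. -/
def letterProd (l : List ℕ) : Equiv.Perm ℤ :=
  (l.map fun i : ℕ => Equiv.swap (i : ℤ) (i + 1)).prod

lemma letterProd_cons (k : ℕ) (l : List ℕ) :
    letterProd (k :: l) = Equiv.swap (k : ℤ) (k + 1) * letterProd l := by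
  simp [letterProd]

lemma fixesOutside_letterProd {n : ℕ} {l : List ℕ} (hl : ∀ i ∈ l, 1 ≤ i ∧ i ≤ n - 1) :
    FixesOutside n (letterProd l) := by
  induction l with
  | nil => intro x _; simp [letterProd]
  | cons k l ih =>
    rw [letterProd_cons]
    have := hl k List.mem_cons_self
    exact (ih fun i hi => hl i (List.mem_cons_of_mem _ hi)).swap_mul (by omega)

lemma card_inversions_one (n : ℕ) : (inversions n 1).card = 0 := by
  rw [Finset.card_eq_zero, Finset.eq_empty_iff_forall_notMem]
  rintro ⟨a, b⟩ h
  rw [mem_inversions] at h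
  simp only [Equiv.Perm.one_apply] at h
  omega

lemma card_inversions_letterProd {n : ℕ} {l : List ℕ} (hl : ∀ i ∈ l, 1 ≤ i ∧ i ≤ n - 1) :
    (inversions n (letterProd l)).card ≤ l.length ∧
      ((inversions n (letterProd l)).card = l.length → IsDescending l (letterProd l)) := by
  induction l with
  | nil => simp [letterProd, card_inversions_one, IsDescending]
  | cons k l ih =>
    have hk := hl k List.mem_cons_self
    have hl' : ∀ i ∈ l, 1 ≤ i ∧ i ≤ n - 1 := fun i hi => hl i (List.mem_cons_of_mem _ hi)
    have hfix := fixesOutside_letterProd hl'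
    have hk' : 1 ≤ (k : ℤ) ∧ (k : ℤ) < n := by omega
    obtain ⟨h₁, h₂⟩ := ih hl'
    have h₃ := card_inversions_swap_mul_le hfix hk'
    rw [letterProd_cons, List.length_cons]
    refine ⟨by omega, fun h => ⟨?_, ?_⟩⟩
    · refine leftDescent_swap_mul fun hd => ?_
      have := card_inversions_of_leftDescent hfix hd
      omega
    · rw [Equiv.swap_mul_self_mul]
      exact h₂ (by omega)

lemma IsDescending.isWord {n : ℕ} {l : List ℕ} {w : Equiv.Perm ℤ} (h : IsDescending l w)
    (hw : FixesOutside n w) :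
    (∀ i ∈ l, 1 ≤ i ∧ i ≤ n - 1) ∧ letterProd l = w ∧ l.length = (inversions n w).card := by
  induction l generalizing w with
  | nil =>
    obtain rfl : w = 1 := h
    simp [letterProd, card_inversions_one]
  | cons k l ih =>
    obtain ⟨h₁, h₂⟩ := h
    have hk := hw.one_le_and_lt h₁
    obtain ⟨h₃, h₄, h₅⟩ := ih h₂ (hw.swap_mul hk)
    refine ⟨fun i hi => ?_, ?_, ?_⟩
    · rcases List.mem_cons.1 hi with rfl | hi
      · omega
      · exact h₃ i hi
    · rw [letterProd_cons, h₄, Equiv.swap_mul_self_mul]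
    · rw [List.length_cons, h₅, card_inversions_of_leftDescent hw h₁]

lemma FixesOutside.eq_one {n : ℕ} {w : Equiv.Perm ℤ} (hw : FixesOutside n w)
    (hno : ∀ k, ¬ LeftDescent w k) : w = 1 := by
  have hmono : StrictMono w.symm := strictMono_int_of_lt_succ fun k => by
    have h₁ := hno k
    have h₂ := w.symm.injective.ne (lt_add_one k).ne
    rw [LeftDescent] at h₁
    omega
  have h0 : w.symm 0 = 0 := by rw [Equiv.symm_apply_eq, hw 0 (by omega)]
  exact inv_eq_one.1 (perm_int_eq_one_of_strictMono w.symm hmono h0)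

lemma exists_isDescending {n : ℕ} (w : Equiv.Perm ℤ) (hw : FixesOutside n w) :
    ∃ l, IsDescending l w := by
  induction hd : (inversions n w).card using Nat.strong_induction_on generalizing w with
  | _ d ih =>
    by_cases hex : ∃ k, LeftDescent w k
    · obtain ⟨k, hk⟩ := hex
      have hkn := hw.one_le_and_lt hk
      have hc := card_inversions_of_leftDescent hw hk
      obtain ⟨l, hl⟩ := ih _ (by omega) _ (hw.swap_mul hkn) rfl
      refine ⟨k.toNat :: l, ?_⟩
      rw [IsDescending, Int.toNat_of_nonneg (by omega)]
      exact ⟨hk, hl⟩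
    · exact ⟨[], hw.eq_one (not_exists.1 hex)⟩

/-- Descending words are counted by descending chains. -/
theorem card_isDescending {N : ℤ} {n : ℕ} (hN : n < N) (ℓ : ℕ) (w : Equiv.Perm ℤ)
    (hw : FixesOutside n w) :
    Finite {l : List ℕ // l.length = ℓ ∧ IsDescending l w} ∧
      (Nat.card {l : List ℕ // l.length = ℓ ∧ IsDescending l w} : ℤ) = chainCount N ℓ w := by
  induction ℓ generalizing w with
  | zero =>
    by_cases h : w = 1
    · have : Unique {l : List ℕ // l.length = 0 ∧ IsDescending l w} :=
        { default := ⟨[], rfl, h⟩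
          uniq := fun l => Subtype.ext (List.length_eq_zero_iff.1 l.2.1) }
      refine ⟨inferInstance, ?_⟩
      rw [Nat.card_unique]
      simp [chainCount, h]
    · have : IsEmpty {l : List ℕ // l.length = 0 ∧ IsDescending l w} := ⟨fun l => by
        have h₁ := l.2.2
        rw [List.length_eq_zero_iff.1 l.2.1] at h₁
        exact h h₁⟩
      refine ⟨inferInstance, ?_⟩
      rw [Nat.card_of_isEmpty]
      simp [chainCount, h]
  | succ ℓ ih =>
    let S := (Finset.range n).filter fun k : ℕ => LeftDescent w k
    have hS : ∀ k : ℕ, k ∈ S ↔ LeftDescent w k := by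
      intro k
      simp only [S, Finset.mem_filter, Finset.mem_range, and_iff_right_iff_imp]
      intro h
      have := hw.one_le_and_lt h
      omega
    have step := fun k : S => ih _ (hw.swap_mul (hw.one_le_and_lt ((hS k).1 k.2)))
    have hfin : ∀ k : S, Finite {l : List ℕ // l.length = ℓ ∧
      IsDescending l (Equiv.swap (k.1 : ℤ) (k.1 + 1) * w)} := fun k => (step k).1
    let F : (Σ k : S, {l : List ℕ // l.length = ℓ ∧
        IsDescending l (Equiv.swap (k.1 : ℤ) (k.1 + 1) * w)}) →
        {l : List ℕ // l.length = ℓ + 1 ∧ IsDescending l w} := fun x =>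
      ⟨x.1.1 :: x.2.1, by rw [List.length_cons, x.2.2.1], (hS _).1 x.1.2, x.2.2.2⟩
    have hF : Function.Bijective F := by
      constructor
      · rintro ⟨⟨k, hk⟩, ⟨l, hl⟩⟩ ⟨⟨k', hk'⟩, ⟨l', hl'⟩⟩ h
        obtain ⟨rfl, rfl⟩ := List.cons.inj (congrArg Subtype.val h)
        rfl
      · rintro ⟨l, hl₁, hl₂⟩
        cases l with
        | nil => simp at hl₁
        | cons k l =>
          exact ⟨⟨⟨k, (hS k).2 hl₂.1⟩, ⟨l, by simpa using hl₁, hl₂.2⟩⟩, rfl⟩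
    refine ⟨Finite.of_surjective F hF.2, ?_⟩
    rw [← Nat.card_congr (Equiv.ofBijective F hF), Nat.card_sigma, Nat.cast_sum,
      Finset.sum_congr rfl fun k _ => (step k).2,
      Finset.sum_coe_sort S fun k : ℕ => chainCount N ℓ (Equiv.swap (k : ℤ) (k + 1) * w),
      chainCount, ← Finset.sum_filter]
    refine Finset.sum_nbij (fun k : ℕ => (k : ℤ)) ?_ ?_ ?_ fun _ _ => rfl
    · intro k hk
      have hk := (hS k).1 hk
      have := hw.one_le_and_lt hk
      exact Finset.mem_filter.2 ⟨Finset.mem_Ico.2 (by omega), hk⟩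
    · intro a _ b _ h
      exact Int.natCast_inj.1 h
    · intro k hk
      rw [Finset.mem_coe, Finset.mem_filter] at hk
      have := hw.one_le_and_lt hk.2
      refine ⟨k.toNat, Finset.mem_coe.2 ((hS _).2 ?_), Int.toNat_of_nonneg (by omega)⟩
      rw [Int.toNat_of_nonneg (by omega)]
      exact hk.2

/-- The permutation of `ℤ` reversing `{1, …, n}`. -/
def reversal (n : ℕ) : Equiv.Perm ℤ :=
  Function.Involutive.toPerm (fun p => if 1 ≤ p ∧ p ≤ n then n + 1 - p else p) fun p => by
    dsimp only; split_ifs <;> omega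

lemma reversal_apply (n : ℕ) (p : ℤ) :
    reversal n p = if 1 ≤ p ∧ p ≤ n then n + 1 - p else p := rfl

lemma fixesOutside_reversal (n : ℕ) : FixesOutside n (reversal n) := fun x hx => by
  rw [reversal_apply, if_neg (by omega)]

lemma letterProd_apply {n : ℕ} {l : List ℕ} (hl : ∀ i ∈ l, 1 ≤ i ∧ i ≤ n - 1) (x : Fin n) :
    letterProd l ((x : ℤ) + 1) = (wordProd n l x : ℤ) + 1 := by
  induction l with
  | nil => simp [letterProd, wordProd]
  | cons k l ih =>
    have hk := hl k List.mem_cons_self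
    have e : wordProd n (k :: l) = simpleRefl n k * wordProd n l := by simp [wordProd]
    rw [letterProd_cons, e, Equiv.Perm.mul_apply, Equiv.Perm.mul_apply,
      ih fun i hi => hl i (List.mem_cons_of_mem _ hi), simpleRefl, dif_pos (by omega)]
    simp only [Equiv.swap_apply_def, Fin.ext_iff]
    split_ifs <;> (try dsimp only at *) <;> omega

lemma isWordFor_w₀_iff {n : ℕ} (l : List ℕ) :
    IsWordFor n (w₀ n) l ↔ (∀ i ∈ l, 1 ≤ i ∧ i ≤ n - 1) ∧ letterProd l = reversal n := by
  refine and_congr_right fun hl => ⟨fun h => ?_, fun h => ?_⟩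
  · ext p
    by_cases hp : 1 ≤ p ∧ p ≤ n
    · have := letterProd_apply hl ⟨(p - 1).toNat, by omega⟩
      rw [h, w₀, Fin.revPerm_apply, Fin.val_rev] at this
      dsimp only at this
      rw [Int.toNat_of_nonneg (by omega), sub_add_cancel] at this
      rw [this, reversal_apply, if_pos hp]
      omega
    · rw [fixesOutside_letterProd hl p (by omega), fixesOutside_reversal n p (by omega)]
  · ext x
    have := letterProd_apply hl x
    have hx := x.2
    rw [h, reversal_apply, if_pos (by omega)] at this
    rw [w₀, Fin.revPerm_apply, Fin.val_rev]
    omega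

lemma isReducedWordFor_w₀_iff {n : ℕ} (l : List ℕ) :
    IsReducedWordFor n (w₀ n) l ↔
      l.length = (inversions n (reversal n)).card ∧ IsDescending l (reversal n) := by
  have hlow : ∀ l', IsWordFor n (w₀ n) l' → (inversions n (reversal n)).card ≤ l'.length := by
    intro l' hl'
    obtain ⟨h₁, h₂⟩ := (isWordFor_w₀_iff l').1 hl'
    rw [← h₂]
    exact (card_inversions_letterProd h₁).1
  constructor
  · rintro ⟨h₁, h₂⟩
    obtain ⟨l₀, h₀⟩ := exists_isDescending _ (fixesOutside_reversal n)
    obtain ⟨h₃, h₄, h₅⟩ := h₀.isWord (fixesOutside_reversal n)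
    have h₆ := h₂ l₀ ((isWordFor_w₀_iff l₀).2 ⟨h₃, h₄⟩)
    have h₇ : l.length = (inversions n (reversal n)).card :=
      le_antisymm (h₅ ▸ h₆) (hlow l h₁)
    refine ⟨h₇, ?_⟩
    obtain ⟨h₈, h₉⟩ := (isWordFor_w₀_iff l).1 h₁
    rw [← h₉] at h₇ ⊢
    exact (card_inversions_letterProd h₈).2 h₇.symm
  · rintro ⟨h₁, h₂⟩
    obtain ⟨h₃, h₄, -⟩ := h₂.isWord (fixesOutside_reversal n)
    exact ⟨(isWordFor_w₀_iff l).2 ⟨h₃, h₄⟩, fun l' hl' => h₁ ▸ hlow l' hl'⟩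

/-- The cells of the staircase diagram. -/
def staircaseCells (n : ℕ) : Finset (ℕ × ℕ) :=
  (Finset.range (n - 1) ×ˢ Finset.range (n - 1)).filter fun p => p.1 + p.2 < n - 1

lemma mem_staircaseCells {n i j : ℕ} : (i, j) ∈ staircaseCells n ↔ j < n - 1 - i := by
  simp only [staircaseCells, Finset.mem_filter, Finset.mem_product, Finset.mem_range]
  omega

lemma mem_cellsOf_staircase {n i j : ℕ} : (i, j) ∈ cellsOf (staircase n) ↔ j < n - 1 - i := by
  have key : ∀ m : ℕ, ((List.range m).filter fun x => decide (j < x + 1)).length = m - j := by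
    intro m
    induction m with
    | zero => simp
    | succ m ih =>
      rw [List.range_succ, List.filter_append, List.length_append, ih, List.filter_singleton]
      by_cases h : j < m + 1
      · simp [h]; omega
      · simp [h]; omega
  have : ((staircase n).filter fun m => j < m).card = n - 1 - j := by
    rw [← key (n - 1), staircase, Multiset.filter_coe, Multiset.coe_card, List.filter_map,
      List.length_map]
    rfl
  change i < ((staircase n).filter fun m => j < m).card ↔ _
  rw [this]
  omega

lemma card_staircaseCells (n : ℕ) : (staircaseCells n).card = (staircase n).sum := by
  have : (staircase n).sum = ((Finset.range (n - 1)).sigma fun s => Finset.range (s + 1)).card := by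
    rw [Finset.card_sigma, staircase, Multiset.sum_coe]
    simp only [Finset.card_range]
    rfl
  rw [this]
  refine Finset.card_nbij' (fun p => ⟨p.1 + p.2, p.2⟩) (fun q => (q.1 - q.2, q.2)) ?_ ?_ ?_ ?_
  · rintro ⟨i, j⟩ h
    rw [Finset.mem_coe, mem_staircaseCells] at h
    simp; omega
  · rintro ⟨s, j⟩ h
    simp at h
    rw [Finset.mem_coe, mem_staircaseCells]
    dsimp only
    omega
  · rintro ⟨i, j⟩ _
    simp
  · rintro ⟨s, j⟩ h
    simp at h
    simp; omega

lemma card_inversions_reversal (n : ℕ) :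
    (inversions n (reversal n)).card = (staircase n).sum := by
  rw [← card_staircaseCells]
  refine Finset.card_nbij' (fun p => ((p.1 - 1).toNat, (n - p.2).toNat))
    (fun q => ((q.1 : ℤ) + 1, (n : ℤ) - q.2)) ?_ ?_ ?_ ?_
  · rintro ⟨a, b⟩ h
    rw [Finset.mem_coe, mem_inversions] at h
    rw [Finset.mem_coe, mem_staircaseCells]
    omega
  · rintro ⟨i, j⟩ h
    rw [Finset.mem_coe, mem_staircaseCells] at h
    rw [Finset.mem_coe, mem_inversions, reversal_apply, reversal_apply]
    split_ifs <;> omega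
  · rintro ⟨a, b⟩ h
    rw [Finset.mem_coe, mem_inversions] at h
    simp only [Prod.mk.injEq]; omega
  · rintro ⟨i, j⟩ h
    rw [Finset.mem_coe, mem_staircaseCells] at h
    simp only [Prod.mk.injEq]; omega

lemma isSYT_staircase_iff (n : ℕ) (T : ℕ × ℕ → ℕ) :
    IsSYT (staircase n) T ↔ IsStdFilling (staircase n).sum (fun i => n - 1 - i) T := by
  simp only [IsSYT, IsStdFilling, Prod.forall, mem_cellsOf_staircase, not_lt]
  have cellp : ∀ p : ℕ × ℕ, p ∈ cellsOf (staircase n) ↔ p.2 < n - 1 - p.1 :=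
    fun p => mem_cellsOf_staircase
  simp only [cellp]
  refine ⟨fun ⟨h₁, h₂, h₃, h₄⟩ => ⟨h₁, ?_, h₂, h₃, h₄⟩,
    fun ⟨h₁, _, h₂, h₃, h₄⟩ => ⟨h₁, h₂, h₃, h₄⟩⟩
  let C := (staircaseCells n).filter fun p => 1 ≤ T p ∧ T p ≤ (staircase n).sum
  have hC : (staircaseCells n).card ≤ C.card := by
    have hsub : Finset.Icc 1 (staircase n).sum ⊆ C.image T := by
      intro m hm
      rw [Finset.mem_Icc] at hm
      obtain ⟨⟨i, j⟩, ⟨hp₁, hp₂⟩, -⟩ := h₂ m hm.1 hm.2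
      exact Finset.mem_image.2 ⟨(i, j),
        Finset.mem_filter.2 ⟨mem_staircaseCells.2 hp₁, by rw [hp₂]; exact hm⟩, hp₂⟩
    have := (Finset.card_le_card hsub).trans Finset.card_image_le
    rwa [Nat.card_Icc, Nat.add_sub_cancel, ← card_staircaseCells] at this
  have hCeq := Finset.eq_of_subset_of_card_le (Finset.filter_subset _ _) hC
  intro i j hij
  have hmem : (i, j) ∈ C := by
    rw [show C = staircaseCells n from hCeq]; exact mem_staircaseCells.2 hij
  exact (Finset.mem_filter.1 hmem).2

/-- The number of reduced words for the longest element `w₀ ∈ S_n` equals `f^(δ_n)`,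
the number of standard Young tableaux of the staircase shape `δ_n = (n-1, …, 2, 1)`. -/
theorem reduced_word_count_longest (n : ℕ) (hn : 2 ≤ n) :
    Nat.card {l : List ℕ // IsReducedWordFor n (w₀ n) l} = sytCount (staircase n) := by
  simp only [sytCount, isReducedWordFor_w₀_iff, isSYT_staircase_iff, card_inversions_reversal]
  have hrev : ∀ p, reversal n p = interpolation n 0 0 p := by
    intro p
    rw [reversal_apply]
    unfold interpolation
    split_ifs <;> omega
  obtain ⟨u, hu, hc⟩ := exists_interpolation (reversal n) hrev (n - 2) (by omega) (n - 1) (by omega)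
  have hwords := (card_isDescending (N := (n : ℤ) + 3) (by omega) (staircase n).sum _
    (fixesOutside_reversal n)).2
  have hfill := (card_isStdFilling ((n : ℤ) + 3) n (by omega) (staircase n).sum
    (fun i => n - 1 - i) u (fun a b h => by dsimp only; omega) (fun i => ?_)
    (fun p q hp hpq => ?_) (by omega) (by omega)).2
  · rw [← hc, ← hfill] at hwords
    exact_mod_cast hwords
  · rw [hu]
    unfold interpolation
    split_ifs <;> omega
  · rw [hu, hu]
    unfold interpolation
    split_ifs <;> omega
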